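/- arXiv:math/0005094 — 3 statements merged into one kernel-verified Lean document; each statement's English description precedes it below -/
import Mathlib

section
/- Let V : ℕ → ℕ → ℝ be a function with V g n ≥ 0 for all g, n, satisfying: (i) for all g ≥ 2 and n ≥ 0, V g (n+1) ≥ (1/2)·(3g−2+n)·(7g−7+3n)·V g n + 1/(24^g · g!); and (ii) there exist a real c₀ > 0 and g₀ ∈ ℕ such that V g 1 ≥ c₀^g · (2g)! · (3g−2)! for all g ≥ g₀. Then there exists a real c > 0, independent of n, such that for every n ≥ 1 there is G ∈ ℕ with V g n ≥ c^g · (2g)! · (3g−3+n)! for all g ≥ G. -/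
open Nat

theorem lower_asymptotic_estimate
    (V : ℕ → ℕ → ℝ)
    (hpos : ∀ g n, 0 ≤ V g n)
    (hrec : ∀ g n, 2 ≤ g →
      V g (n + 1) ≥ (1/2) * ((3:ℝ) * g - 2 + n) * ((7:ℝ) * g - 7 + 3 * n) * V g n
        + 1 / (24 ^ g * (g)!))
    (hPenner : ∃ c₀ : ℝ, 0 < c₀ ∧ ∃ g₀ : ℕ, ∀ g, g₀ ≤ g →
      V g 1 ≥ c₀ ^ g * ((2 * g)! : ℝ) * ((3 * g - 2)! : ℝ)) :
    ∃ c : ℝ, 0 < c ∧ ∀ n, 1 ≤ n → ∃ G : ℕ, ∀ g, G ≤ g →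
      V g n ≥ c ^ g * ((2 * g)! : ℝ) * ((3 * g - 3 + n)! : ℝ) := by
  obtain ⟨c, hc, g₀, hP⟩ := hPenner
  refine ⟨c, hc, fun n hn => ⟨max g₀ 2, fun g hg => ?_⟩⟩
  have hg0 : g₀ ≤ g := le_trans (le_max_left _ _) hg
  have hg2 : 2 ≤ g := le_trans (le_max_right _ _) hg
  induction n, hn using Nat.le_induction with
  | base =>
    rw [show 3 * g - 3 + 1 = 3 * g - 2 by omega]
    exact hP g hg0
  | succ n hn ih =>
    have hgR : (2 : ℝ) ≤ g := by exact_mod_cast hg2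
    have hnR : (0 : ℝ) ≤ n := n.cast_nonneg
    have hcast : ((3 * g - 3 + n + 1 : ℕ) : ℝ) = 3 * g - 2 + n := by
      push_cast [Nat.cast_sub (show 3 ≤ 3 * g by omega)]
      ring
    have hfactor : (3 : ℝ) * g - 2 + n
        ≤ (1/2) * ((3:ℝ) * g - 2 + n) * ((7:ℝ) * g - 7 + 3 * n) := by
      nlinarith
    have hrem : (0 : ℝ) ≤ 1 / (24 ^ g * (g)!) := by positivity
    rw [← add_assoc, Nat.factorial_succ, Nat.cast_mul, hcast]
    calc c ^ g * ((2 * g)! : ℝ) * (((3 : ℝ) * g - 2 + n) * ((3 * g - 3 + n)! : ℝ))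
        = ((3 : ℝ) * g - 2 + n) * (c ^ g * ((2 * g)! : ℝ) * ((3 * g - 3 + n)! : ℝ)) := by ring
      _ ≤ ((3 : ℝ) * g - 2 + n) * V g n :=
        mul_le_mul_of_nonneg_left ih (by linarith)
      _ ≤ (1/2) * ((3:ℝ) * g - 2 + n) * ((7:ℝ) * g - 7 + 3 * n) * V g n :=
        mul_le_mul_of_nonneg_right hfactor (hpos g n)
      _ ≤ V g (n + 1) := by linarith [hrec g n hg2]
end

section
/- Let V : ℕ → ℕ → ℝ be a function such that: (i) for all g ≥ 2, (1/672)·V (g−1) 1 ≤ V g 0 and V g 0 ≤ 2·V g 1 / ((3g−2)·(7g−7)); and (ii) there exist reals 0 < c < C and g₀ ∈ ℕ with c^g · (2g)! · (3g−2)! ≤ V g 1 ≤ C^g · (2g)! · (3g−2)! for all g ≥ g₀. Then log(V g 0 / (3g−3)!) / (g · log g) converges to 2 as g → ∞. -/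
open Nat Filter Real

theorem log_factorial_le_mul_log (n : ℕ) : Real.log (n ! : ℝ) ≤ n * Real.log n := by
  rw [← Real.log_pow]
  exact Real.log_le_log (by positivity) (by exact_mod_cast Nat.factorial_le_pow n)

theorem mul_log_sub_le_log_factorial {n : ℕ} (hn : n ≠ 0) :
    n * Real.log n - n ≤ Real.log (n ! : ℝ) := by
  have hn0 : (0 : ℝ) < n := by positivity
  have h := Real.log_le_log (by positivity) (Real.pow_div_factorial_le_exp (n : ℝ) hn0.le n)
  rw [Real.log_exp, Real.log_div (by positivity) (by positivity), Real.log_pow] at h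
  linarith

theorem upper_ratio_bound {v w C : ℝ} {g : ℕ} (hg : 2 ≤ g) (hC : 0 < C)
    (hv : v ≤ 2 * w / (((3 : ℝ) * g - 2) * ((7 : ℝ) * g - 7)))
    (hw : w ≤ C ^ g * ((2 * g)! : ℝ) * ((3 * g - 2)! : ℝ)) :
    v / ((3 * g - 3)! : ℝ) ≤ C ^ g * ((2 * g)! : ℝ) := by
  obtain ⟨k, rfl⟩ := Nat.exists_eq_add_of_le' hg
  have e₁ : 3 * (k + 2) - 2 = (3 * k + 3) + 1 := by omega
  have e₂ : 3 * (k + 2) - 3 = 3 * k + 3 := by omega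
  rw [e₁, Nat.factorial_succ] at hw
  rw [e₂, div_le_iff₀ (by positivity)]
  have hk : (0 : ℝ) ≤ k := k.cast_nonneg
  have hden : (0 : ℝ) < ((3 : ℝ) * (k + 2 : ℕ) - 2) * ((7 : ℝ) * (k + 2 : ℕ) - 7) := by
    push_cast
    exact mul_pos (by linarith) (by linarith)
  refine hv.trans ?_
  rw [div_le_iff₀ hden]
  push_cast at hw ⊢
  set P : ℝ := C ^ (k + 2) * ((2 * (k + 2))! : ℝ) * ((3 * k + 3)! : ℝ) with hP
  have hP0 : 0 < P := by positivity
  have hw' : w ≤ P * (3 * k + 4) := by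
    refine hw.trans (le_of_eq ?_)
    rw [hP]; ring
  nlinarith [mul_nonneg hP0.le hk, mul_nonneg (mul_nonneg hP0.le hk) hk]

theorem lower_ratio_bound {v w c : ℝ} {g : ℕ} (hg : 2 ≤ g) (hc : 0 < c)
    (hv : (1 / 672) * w ≤ v)
    (hw : c ^ (g - 1) * ((2 * (g - 1))! : ℝ) * ((3 * (g - 1) - 2)! : ℝ) ≤ w) :
    c ^ (g - 1) * ((2 * g)! : ℝ) / (24192 * (g : ℝ) ^ 4) ≤ v / ((3 * g - 3)! : ℝ) := by
  obtain ⟨k, rfl⟩ := Nat.exists_eq_add_of_le' hg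
  have e₁ : k + 2 - 1 = k + 1 := by omega
  have e₂ : 3 * (k + 1) - 2 = 3 * k + 1 := by omega
  have e₃ : 3 * (k + 2) - 3 = (3 * k + 1) + 1 + 1 := by omega
  have e₄ : 2 * (k + 2) = 2 * (k + 1) + 1 + 1 := by omega
  rw [e₁, e₂] at hw
  rw [e₁, e₃, e₄, div_le_div_iff₀ (by positivity) (by positivity)]
  simp only [Nat.factorial_succ (3 * k + 1 + 1), Nat.factorial_succ (3 * k + 1),
    Nat.factorial_succ (2 * (k + 1) + 1), Nat.factorial_succ (2 * (k + 1))]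
  push_cast
  set P : ℝ := c ^ (k + 1) * ((2 * (k + 1))! : ℝ) * ((3 * k + 1)! : ℝ) with hP
  have hP0 : 0 < P := by positivity
  have hk : (0 : ℝ) ≤ k := k.cast_nonneg
  have hpoly : (2 * ((k : ℝ) + 1) + 1 + 1) * (2 * (k + 1) + 1) * ((3 * k + 1 + 1 + 1) *
      (3 * k + 1 + 1)) ≤ 36 * (k + 2) ^ 4 := by
    have h₁ : (2 * ((k : ℝ) + 1) + 1 + 1) * (2 * (k + 1) + 1) ≤ (2 * (k + 2)) * (2 * (k + 2)) := by
      gcongr <;> linarith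
    have h₂ : (3 * (k : ℝ) + 1 + 1 + 1) * (3 * k + 1 + 1) ≤ (3 * (k + 2)) * (3 * (k + 2)) := by
      gcongr <;> linarith
    refine (mul_le_mul h₁ h₂ (by positivity) (by positivity)).trans (le_of_eq (by ring))
  calc _ = P * ((2 * ((k : ℝ) + 1) + 1 + 1) * (2 * (k + 1) + 1) * ((3 * k + 1 + 1 + 1) *
      (3 * k + 1 + 1))) := by rw [hP]; ring
    _ ≤ P * (36 * (k + 2) ^ 4) := by gcongr
    _ = (1 / 672 * P) * (24192 * ((k : ℝ) + 2) ^ 4) := by ring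
    _ ≤ v * (24192 * ((k : ℝ) + 2) ^ 4) := by
      gcongr
      linarith

theorem Vg0_log_asymptotic
    (V : ℕ → ℕ → ℝ)
    (hsandwich : ∀ g, 2 ≤ g →
      (1/672) * V (g - 1) 1 ≤ V g 0 ∧
      V g 0 ≤ 2 * V g 1 / (((3:ℝ) * g - 2) * ((7:ℝ) * g - 7)))
    (hV1 : ∃ c C : ℝ, 0 < c ∧ c < C ∧ ∃ g₀ : ℕ, ∀ g, g₀ ≤ g →
      c ^ g * ((2 * g)! : ℝ) * ((3 * g - 2)! : ℝ) ≤ V g 1 ∧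
      V g 1 ≤ C ^ g * ((2 * g)! : ℝ) * ((3 * g - 2)! : ℝ)) :
    Filter.Tendsto
      (fun g : ℕ => Real.log (V g 0 / ((3 * g - 3)! : ℝ)) / (g * Real.log g))
      Filter.atTop (nhds 2) := by
  obtain ⟨c, C, hc, hcC, g₀, hV⟩ := hV1
  have hC : 0 < C := hc.trans hcC
  have hcast : Tendsto (fun g : ℕ => (g : ℝ)) atTop atTop := tendsto_natCast_atTop_atTop
  have hlog : Tendsto (fun g : ℕ => Real.log g) atTop atTop := tendsto_log_atTop.comp hcast
  have hinv : Tendsto (fun g : ℕ => (g : ℝ)⁻¹) atTop (nhds 0) := tendsto_inv_atTop_zero.comp hcast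
  have hloginv : Tendsto (fun g : ℕ => (Real.log g)⁻¹) atTop (nhds 0) :=
    tendsto_inv_atTop_zero.comp hlog
  have hupper : Tendsto (fun g : ℕ => 2 + (Real.log C + 2 * Real.log 2) * (Real.log g)⁻¹)
      atTop (nhds 2) := by
    simpa using (hloginv.const_mul (Real.log C + 2 * Real.log 2)).const_add 2
  have hlower : Tendsto (fun g : ℕ => 2 + (Real.log c + 2 * Real.log 2 - 2) * (Real.log g)⁻¹
      - 4 * (g : ℝ)⁻¹ - (Real.log c + Real.log 24192) * ((g : ℝ)⁻¹ * (Real.log g)⁻¹))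
      atTop (nhds 2) := by
    simpa using (((hloginv.const_mul (Real.log c + 2 * Real.log 2 - 2)).const_add 2).sub
      (hinv.const_mul 4)).sub ((hinv.mul hloginv).const_mul (Real.log c + Real.log 24192))
  have hlarge : ∀ᶠ g : ℕ in atTop, g₀ + 2 ≤ g := eventually_ge_atTop _
  refine tendsto_of_tendsto_of_tendsto_of_le_of_le' hlower hupper ?_ ?_
  all_goals
    filter_upwards [hlarge] with g hg
    have hg2 : 2 ≤ g := by omega
    have hlow := lower_ratio_bound hg2 hc (hsandwich g hg2).1 (hV (g - 1) (by omega)).1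
    have hupp := upper_ratio_bound hg2 hC (hsandwich g hg2).2 (hV g (by omega)).2
    have hg0 : (0 : ℝ) < g := by positivity
    have hlogg : 0 < Real.log g := Real.log_pos (by exact_mod_cast hg2)
    have hlog2 : Real.log ((2 * g : ℕ) : ℝ) = Real.log 2 + Real.log g := by
      push_cast
      exact Real.log_mul (by norm_num) hg0.ne'
    have hlowpos : 0 < c ^ (g - 1) * ((2 * g)! : ℝ) / (24192 * (g : ℝ) ^ 4) := by positivity
  · rw [le_div_iff₀ (by positivity)]
    have h := Real.log_le_log hlowpos hlow
    rw [Real.log_div (by positivity) (by positivity), Real.log_mul (by positivity) (by positivity),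
      Real.log_mul (by norm_num) (by positivity), Real.log_pow, Real.log_pow,
      Nat.cast_sub (by omega)] at h
    have hfact := mul_log_sub_le_log_factorial (n := 2 * g) (by omega)
    rw [hlog2] at hfact
    push_cast at h hfact
    refine le_trans (b := (g - 1) * Real.log c +
      (2 * g * (Real.log 2 + Real.log g) - 2 * g) - (Real.log 24192 + 4 * Real.log g)) (le_of_eq ?_) ?_
    · field_simp
      ring
    · linarith
  · rw [div_le_iff₀ (by positivity)]
    have h := Real.log_le_log (hlowpos.trans_le hlow) hupp
    rw [Real.log_mul (by positivity) (by positivity), Real.log_pow] at h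
    have hfact := log_factorial_le_mul_log (2 * g)
    rw [hlog2] at hfact
    push_cast at hfact
    refine h.trans (le_trans (add_le_add_right hfact _) (le_of_eq ?_))
    field_simp
    ring
end

section
/- Fix n ≥ 1 and let V : ℕ → ℕ → ℝ be a function with V g m ≥ 0 for all g, m, satisfying: (i) for all g ≥ 2 and m ≥ 0, V g (m+1) ≥ (1/2)·(3g−2+m)·(7g−7+3m)·V g m + 1/(24^g · g!); (ii) there exist c₀ > 0 and g₀ with V g 1 ≥ c₀^g · (2g)! · (3g−2)! for all g ≥ g₀; and (iii) there exist C₀ > 0 and g₁ with V g n ≤ C₀^g · (2g)! · (3g−3+n)! for all g ≥ g₁. Then log(V g n / (3g−3+n)!) / (g · log g) converges to 2 as g → ∞. -/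
open Nat Filter Real

lemma log_factorial_two_mul_le {g : ℕ} (hg : 1 ≤ g) :
    Real.log ((2 * g)! : ℝ) ≤ 2 * g * (Real.log 2 + Real.log g) := by
  have hg' : (0 : ℝ) < g := by exact_mod_cast hg
  have h : ((2 * g)! : ℝ) ≤ (2 * g : ℝ) ^ (2 * g) := by
    exact_mod_cast Nat.factorial_le_pow (2 * g)
  calc Real.log ((2 * g)! : ℝ) ≤ Real.log ((2 * g : ℝ) ^ (2 * g)) :=
        Real.log_le_log (by positivity) h
    _ = 2 * g * (Real.log 2 + Real.log g) := by
        rw [Real.log_pow, Real.log_mul (by norm_num) hg'.ne']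
        push_cast
        ring

lemma le_log_factorial_two_mul {g : ℕ} (hg : 1 ≤ g) :
    2 * g * (Real.log 2 + Real.log g) - 2 * g ≤ Real.log ((2 * g)! : ℝ) := by
  have hg' : (1 : ℝ) ≤ g := by exact_mod_cast hg
  have h := Stirling.le_log_factorial_stirling (n := 2 * g) (by omega)
  have hlog : 0 ≤ Real.log (((2 * g : ℕ) : ℝ)) := Real.log_natCast_nonneg _
  have hpi : 0 ≤ Real.log (2 * π) := Real.log_nonneg (by linarith [Real.pi_gt_three])
  have hsplit : Real.log (((2 * g : ℕ) : ℝ)) = Real.log 2 + Real.log g := by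
    rw [Nat.cast_mul, Real.log_mul (by norm_num) (by positivity)]
    norm_num
  rw [hsplit] at h hlog
  push_cast at h
  linarith

/-- The superlinear recursion propagates a factorial lower bound from one marked point to any
positive number of marked points. -/
lemma factorial_lower_bound_of_recursion {v : ℕ → ℝ} {g : ℕ} {a : ℝ} (hg : 2 ≤ g) (ha : 0 ≤ a)
    (hrec : ∀ m, v (m + 1) ≥ (1/2) * ((3:ℝ) * g - 2 + m) * ((7:ℝ) * g - 7 + 3 * m) * v m
        + 1 / (24 ^ g * (g)!))
    (hone : v 1 ≥ a * ((3 * g - 2)! : ℝ)) (k : ℕ) :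
    a * ((3 * g - 2 + k)! : ℝ) ≤ v (k + 1) := by
  induction k with
  | zero => simpa using hone
  | succ k ih =>
    have hg' : (2 : ℝ) ≤ g := by exact_mod_cast hg
    have hk : (0 : ℝ) ≤ k := k.cast_nonneg
    have h := hrec (k + 1)
    have hrest : (0 : ℝ) ≤ 1 / (24 ^ g * (g)!) := by positivity
    have hfact : ((3 * g - 2 + (k + 1))! : ℝ) = (3 * g - 1 + k) * ((3 * g - 2 + k)! : ℝ) := by
      rw [← add_assoc, Nat.factorial_succ, Nat.cast_mul]
      congr 1
      push_cast [Nat.cast_sub (show 2 ≤ 3 * g by omega)]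
      ring
    have hv : 0 ≤ v (k + 1) := le_trans (by positivity) ih
    push_cast at h
    calc a * ((3 * g - 2 + (k + 1))! : ℝ)
        = (3 * g - 1 + k) * (a * ((3 * g - 2 + k)! : ℝ)) := by rw [hfact]; ring
      _ ≤ (3 * g - 1 + k) * v (k + 1) := mul_le_mul_of_nonneg_left ih (by linarith)
      _ ≤ (1/2) * ((3:ℝ) * g - 2 + (k + 1)) * ((7:ℝ) * g - 7 + 3 * (k + 1)) * v (k + 1) := by
        apply mul_le_mul_of_nonneg_right _ hv
        nlinarith
      _ ≤ v (k + 1 + 1) := by linarith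

lemma tendsto_const_div_log_add (A b : ℝ) :
    Tendsto (fun g : ℕ => A / Real.log g + b) atTop (nhds b) := by
  simpa using ((tendsto_const_nhds (x := A)).div_atTop
    (Real.tendsto_log_atTop.comp tendsto_natCast_atTop_atTop)).add_const b

theorem Vgn_log_asymptotic
    (n : ℕ) (hn : 1 ≤ n)
    (V : ℕ → ℕ → ℝ)
    (hpos : ∀ g m, 0 ≤ V g m)
    (hrec : ∀ g m, 2 ≤ g →
      V g (m + 1) ≥ (1/2) * ((3:ℝ) * g - 2 + m) * ((7:ℝ) * g - 7 + 3 * m) * V g m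
        + 1 / (24 ^ g * (g)!))
    (hPenner : ∃ c₀ : ℝ, 0 < c₀ ∧ ∃ g₀ : ℕ, ∀ g, g₀ ≤ g →
      V g 1 ≥ c₀ ^ g * ((2 * g)! : ℝ) * ((3 * g - 2)! : ℝ))
    (hGrushevsky : ∃ C₀ : ℝ, 0 < C₀ ∧ ∃ g₁ : ℕ, ∀ g, g₁ ≤ g →
      V g n ≤ C₀ ^ g * ((2 * g)! : ℝ) * ((3 * g - 3 + n)! : ℝ)) :
    Filter.Tendsto
      (fun g : ℕ => Real.log (V g n / ((3 * g - 3 + n)! : ℝ)) / (g * Real.log g))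
      Filter.atTop (nhds 2) := by
  obtain ⟨c, hc, g₀, hlow⟩ := hPenner
  obtain ⟨C, hC, g₁, hupp⟩ := hGrushevsky
  have hlower : ∀ g : ℕ, 2 ≤ g → g₀ ≤ g →
      c ^ g * ((2 * g)! : ℝ) ≤ V g n / ((3 * g - 3 + n)! : ℝ) := by
    intro g hg hg0
    rw [le_div_iff₀ (by positivity)]
    have h := factorial_lower_bound_of_recursion hg (by positivity) (fun m => hrec g m hg)
      (hlow g hg0) (n - 1)
    rwa [show n - 1 + 1 = n by omega, show 3 * g - 2 + (n - 1) = 3 * g - 3 + n by omega] at h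
  have hlog_mul : ∀ {x : ℝ}, 0 < x → ∀ g : ℕ, Real.log (x ^ g * ((2 * g)! : ℝ)) =
      g * Real.log x + Real.log ((2 * g)! : ℝ) := by
    intro x hx g
    rw [Real.log_mul (by positivity) (by positivity), Real.log_pow]
  refine tendsto_of_tendsto_of_tendsto_of_le_of_le'
    (tendsto_const_div_log_add (Real.log c + 2 * Real.log 2 - 2) 2)
    (tendsto_const_div_log_add (Real.log C + 2 * Real.log 2) 2) ?_ ?_
  · filter_upwards [eventually_ge_atTop 2, eventually_ge_atTop g₀] with g hg hg0
    have hg' : (1 : ℝ) < g := by exact_mod_cast hg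
    have hL : 0 < Real.log g := Real.log_pos hg'
    have h := Real.log_le_log (by positivity) (hlower g hg hg0)
    rw [hlog_mul hc] at h
    have hf := le_log_factorial_two_mul (g := g) (by omega)
    rw [le_div_iff₀ (by positivity)]
    calc ((Real.log c + 2 * Real.log 2 - 2) / Real.log g + 2) * (g * Real.log g)
        = g * Real.log c + (2 * g * (Real.log 2 + Real.log g) - 2 * g) := by
          field_simp
          ring
      _ ≤ _ := by linarith
  · filter_upwards [eventually_ge_atTop 2, eventually_ge_atTop g₀, eventually_ge_atTop g₁]
      with g hg hg0 hg1
    have hg' : (1 : ℝ) < g := by exact_mod_cast hg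
    have hL : 0 < Real.log g := Real.log_pos hg'
    have hV : 0 < V g n / ((3 * g - 3 + n)! : ℝ) :=
      lt_of_lt_of_le (by positivity) (hlower g hg hg0)
    have h := Real.log_le_log hV ((div_le_iff₀ (by positivity)).2 (hupp g hg1))
    rw [hlog_mul hC] at h
    have hf := log_factorial_two_mul_le (g := g) (by omega)
    rw [div_le_iff₀ (by positivity)]
    calc Real.log (V g n / ((3 * g - 3 + n)! : ℝ))
        ≤ g * Real.log C + 2 * g * (Real.log 2 + Real.log g) := by linarith
      _ = ((Real.log C + 2 * Real.log 2) / Real.log g + 2) * (g * Real.log g) := by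
          field_simp
          ring
end
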